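/- Let R be a commutative ring, π ∈ R, and s ≥ 1 an integer. Let Y be an R-module and let X, Z ⊆ Y be submodules satisfying π·Y ⊆ X, π^s·Y ⊆ Z, and π^{s−1}·X ⊆ Z. Then multiplication by π^{s−1} induces a well-defined R-module homomorphism X/πY → Z/π^sY, the natural map from X[π^{s−1}] to the kernel of this homomorphism (sending an element to its class in X/πY) is surjective, its kernel is exactly π·(Y[π^s]), and consequently ker(X/πY → Z/π^sY) ≅ X[π^{s−1}]/π·(Y[π^s]). -/

import Mathlib

/-- If `L` agrees with `N` on the submodule `K`, then `K ⧸ L` is the image of `K` in `M ⧸ N`. -/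
noncomputable def Submodule.quotientComapEquivMapMkQ {R M : Type*} [CommRing R] [AddCommGroup M]
    [Module R M] (K N L : Submodule R M) (h : N.comap K.subtype = L.comap K.subtype) :
    (↥K ⧸ L.comap K.subtype) ≃ₗ[R] ↥(K.map N.mkQ) :=
  (Submodule.quotEquivOfEq _ _ (by rw [LinearMap.ker_comp, Submodule.ker_mkQ, h])).trans
    ((N.mkQ.comp K.subtype).quotKerEquivRange.trans
      (LinearEquiv.ofEq _ _ (by rw [LinearMap.range_comp, Submodule.range_subtype])))


/-- Let `R` be a commutative ring, `π ∈ R`, `s ≥ 1`, and let `X, Z ⊆ Y` be submodules of an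
`R`-module `Y` with `π·Y ⊆ X`, `π^s·Y ⊆ Z` and `π^{s−1}·X ⊆ Z`.  Then multiplication by
`π^{s−1}` induces a well-defined `R`-homomorphism `f : X/πY → Z/π^sY`; the natural map from
`X[π^{s−1}]` to `ker f` (sending an element to its class in `X/πY`) is surjective (i.e.
`ker f` is the image of `X[π^{s−1}]`), its kernel is exactly `π·(Y[π^s])` (i.e.
`X[π^{s−1}] ∩ πY = π·(Y[π^s])` inside `X`), and consequently
`ker f ≅ X[π^{s−1}] / π·(Y[π^s])`. -/
theorem ker_of_mul_pow_map_on_quotients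
    (R : Type*) [CommRing R] (π : R) (s : ℕ) (hs : 1 ≤ s)
    (Y : Type*) [AddCommGroup Y] [Module R Y] (X Z : Submodule R Y)
    (hπY : ∀ y : Y, π • y ∈ X)
    (hπsY : ∀ y : Y, π ^ s • y ∈ Z)
    (hXZ : ∀ y ∈ X, π ^ (s - 1) • y ∈ Z) :
    ∃ f : (↥X ⧸ (LinearMap.range (LinearMap.lsmul R Y π)).comap X.subtype) →ₗ[R]
        (↥Z ⧸ (LinearMap.range (LinearMap.lsmul R Y (π ^ s))).comap Z.subtype),
      (∀ x : X, f (Submodule.Quotient.mk x)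
          = Submodule.Quotient.mk (⟨π ^ (s - 1) • (x : Y), hXZ _ x.2⟩ : Z)) ∧
      LinearMap.ker f
        = Submodule.map ((LinearMap.range (LinearMap.lsmul R Y π)).comap X.subtype).mkQ
            (LinearMap.ker (LinearMap.lsmul R X (π ^ (s - 1)))) ∧
      LinearMap.ker (LinearMap.lsmul R X (π ^ (s - 1)))
          ⊓ (LinearMap.range (LinearMap.lsmul R Y π)).comap X.subtype
        = (Submodule.map (LinearMap.lsmul R Y π)
            (LinearMap.ker (LinearMap.lsmul R Y (π ^ s)))).comap X.subtype ∧
      Nonempty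
        ((↥(LinearMap.ker (LinearMap.lsmul R X (π ^ (s - 1)))) ⧸
            ((Submodule.map (LinearMap.lsmul R Y π)
                (LinearMap.ker (LinearMap.lsmul R Y (π ^ s)))).comap X.subtype).comap
              (LinearMap.ker (LinearMap.lsmul R X (π ^ (s - 1)))).subtype) ≃ₗ[R]
          ↥(LinearMap.ker f)) := by
  have hpow : ∀ y : Y, π ^ (s - 1) • π • y = π ^ s • y := fun y => by
    rw [smul_smul, pow_sub_one_mul (by lia)]
  let g : X →ₗ[R] Z := (LinearMap.lsmul R Y (π ^ (s - 1))).restrict hXZ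
  have hg : (LinearMap.range (LinearMap.lsmul R Y π)).comap X.subtype ≤
      ((LinearMap.range (LinearMap.lsmul R Y (π ^ s))).comap Z.subtype).comap g := by
    rintro x ⟨y, hy : π • y = x⟩
    exact ⟨y, show π ^ s • y = π ^ (s - 1) • (x : Y) by rw [← hy, hpow]⟩
  have hker : LinearMap.ker (Submodule.mapQ _ _ g hg)
      = Submodule.map ((LinearMap.range (LinearMap.lsmul R Y π)).comap X.subtype).mkQ
          (LinearMap.ker (LinearMap.lsmul R X (π ^ (s - 1)))) := by
    ext q
    obtain ⟨x, rfl⟩ := Submodule.mkQ_surjective _ q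
    constructor
    · intro hx
      obtain ⟨y, hy⟩ := (Submodule.Quotient.mk_eq_zero _).1 hx
      replace hy : π ^ s • y = π ^ (s - 1) • (x : Y) := hy
      refine ⟨x - ⟨π • y, hπY y⟩, Subtype.ext ?_, (Submodule.Quotient.eq _).2 ⟨-y, ?_⟩⟩
      · change π ^ (s - 1) • ((x : Y) - π • y) = 0
        rw [smul_sub, hpow, hy, sub_self]
      · change π • -y = (x : Y) - π • y - x
        rw [smul_neg]
        abel
    · rintro ⟨x', hx', hxx'⟩
      rw [← hxx']
      have hx'0 : π ^ (s - 1) • (x' : Y) = 0 := congrArg Subtype.val hx'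
      exact (Submodule.Quotient.mk_eq_zero _).2
        ⟨0, show π ^ s • (0 : Y) = π ^ (s - 1) • (x' : Y) by rw [smul_zero, hx'0]⟩
  have hinf : LinearMap.ker (LinearMap.lsmul R X (π ^ (s - 1)))
        ⊓ (LinearMap.range (LinearMap.lsmul R Y π)).comap X.subtype
      = (Submodule.map (LinearMap.lsmul R Y π)
          (LinearMap.ker (LinearMap.lsmul R Y (π ^ s)))).comap X.subtype := by
    ext x
    constructor
    · rintro ⟨hx, y, hy : π • y = x⟩
      have hx0 : π ^ (s - 1) • (x : Y) = 0 := congrArg Subtype.val hx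
      exact ⟨y, show π ^ s • y = 0 by rw [← hpow, hy, hx0], hy⟩
    · rintro ⟨y, hy0 : π ^ s • y = 0, hy : π • y = x⟩
      refine ⟨Subtype.ext ?_, y, hy⟩
      change π ^ (s - 1) • (x : Y) = 0
      rw [← hy, hpow, hy0]
  refine ⟨Submodule.mapQ _ _ g hg, fun _ => rfl, hker, hinf, ?_⟩
  rw [hker]
  refine ⟨Submodule.quotientComapEquivMapMkQ _ _ _ ?_⟩
  rw [← hinf, Submodule.comap_inf, Submodule.comap_subtype_self, top_inf_eq]
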